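/- Fix ε>0, μ₀∈(0,1), ω₀>0. Let τ:(0,∞)→ℝ be continuous with τ(ω)≥τ_min>0, let ν:(0,∞)→ℝ be continuous with 0<ν_min≤ν(ω)≤ν_max<∞ and differentiable at ω₀, let η:(0,∞)→[0,1] be measurable and continuous at ω₀, and let C_τ>0 be a constant. Set t₁ := 2ε/(μ₀ν(ω₀)). For θ∈(0,1] define M₀(θ) := (1/(θ³ C_τ)) ∫_{−1}^{0} ∫_0^∞ ∫_0^∞ (η(ω)/τ(ω)) φ_μ((−μ−μ₀)/θ) φ_ω((ω−ω₀)/θ) φ_t((t − 2ε/(|μ|ν(ω)))/θ) e^{−2/(ε|μ|ν(ω)τ(ω))} ψ_t((t−t₁)/θ) 1_{t > 2ε/(|μ|ν(ω))} dt dω dμ. Then lim_{θ→0⁺} M₀(θ) = c₁ η(ω₀) e^{−2/(ε μ₀ ν(ω₀) τ(ω₀))}, where c₁ := (1/(τ(ω₀) C_τ)) ∫_0^∞ ∫_0^∞ ∫_{−1}^{1} φ_μ(μ') φ_ω(ω') φ_t(t') ψ_t( t' − (2ε/(μ₀ν(ω₀))²)(μ'ν(ω₀) + ω'μ₀ν'(ω₀))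 ) dμ' dω' dt'. -/

import Mathlib

open MeasureTheory Real Set Filter

/-- A continuous function vanishing off `[0, 1]` vanishes on `(-∞, 0]`. -/
lemma eq_zero_of_nonpos_of_support_Icc {φ : ℝ → ℝ} (hc : Continuous φ)
    (hs : ∀ y, y ∉ Icc (0:ℝ) 1 → φ y = 0) {y : ℝ} (hy : y ≤ 0) : φ y = 0 := by
  have hcl : IsClosed {x | φ x = 0} := isClosed_eq hc continuous_const
  have hsub : Iio (0:ℝ) ⊆ {x | φ x = 0} := fun x hx => hs x fun h => absurd h.1 (not_le.2 hx)
  have := hcl.closure_subset_iff.2 hsub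
  rw [closure_Iio] at this
  exact this hy

/-- The correlation `x ↦ ∫ φ(s) ψ(s + x) ds`. -/
noncomputable def correlation (φ ψ : ℝ → ℝ) (x : ℝ) : ℝ := ∫ s, φ s * ψ (s + x)

section correlation

variable {φ ψ : ℝ → ℝ}

lemma continuous_correlation (hφ : Continuous φ) (hφs : HasCompactSupport φ)
    (hφ0 : ∀ y, 0 ≤ φ y) (hψ : Continuous ψ) (hψb : ∀ y, ψ y ∈ Icc (0:ℝ) 1) :
    Continuous (correlation φ ψ) := by
  refine continuous_of_dominated (bound := φ) (fun x => ?_) (fun x => ?_)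
    (hφ.integrable_of_hasCompactSupport hφs) ?_
  · exact Continuous.aestronglyMeasurable (by fun_prop)
  · refine .of_forall fun s => ?_
    rw [norm_of_nonneg (mul_nonneg (hφ0 _) (hψb _).1)]
    exact mul_le_of_le_one_right (hφ0 _) (hψb _).2
  · exact .of_forall fun s => by fun_prop

lemma abs_correlation_le (hφ : Continuous φ) (hφs : HasCompactSupport φ)
    (hφ0 : ∀ y, 0 ≤ φ y) (hψb : ∀ y, ψ y ∈ Icc (0:ℝ) 1) (x : ℝ) :
    |correlation φ ψ x| ≤ ∫ s, φ s := by
  rw [← Real.norm_eq_abs]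
  refine norm_integral_le_of_norm_le (μ := volume) (hφ.integrable_of_hasCompactSupport hφs)
    (.of_forall fun s => ?_)
  rw [norm_of_nonneg (mul_nonneg (hφ0 _) (hψb _).1)]
  exact mul_le_of_le_one_right (hφ0 _) (hψb _).2

lemma setIntegral_rescaled_eq_correlation (hφ : Continuous φ)
    (hφs : ∀ y, y ∉ Icc (0:ℝ) 1 → φ y = 0) {θ a b : ℝ} (hθ : 0 < θ) (ha : 0 ≤ a) :
    ∫ t in Ioi (0:ℝ), φ ((t - a) / θ) * ψ ((t - b) / θ) * (if a < t then 1 else 0) =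
      θ * correlation φ ψ ((a - b) / θ) := by
  have hpt : ∀ t, φ ((t - a) / θ) * ψ ((t - b) / θ) * (if a < t then 1 else 0) =
      (fun s => φ s * ψ (s + (a - b) / θ)) ((t - a) / θ) := by
    intro t
    by_cases h : a < t
    · simp only [h, if_true, mul_one]
      congr 2
      ring
    · have h0 : φ ((t - a) / θ) = 0 := eq_zero_of_nonpos_of_support_Icc hφ hφs
        (div_nonpos_of_nonpos_of_nonneg (by linarith) hθ.le)
      simp [h0]
  rw [setIntegral_eq_integral_of_forall_compl_eq_zero]
  · simp_rw [hpt]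
    rw [integral_sub_right_eq_self (fun t => (fun s => φ s * ψ (s + (a - b) / θ)) (t / θ)) a,
      Measure.integral_comp_div (fun s => φ s * ψ (s + (a - b) / θ)), abs_of_pos hθ, smul_eq_mul, correlation]
  · intro t ht
    rw [if_neg (fun h => ht (ha.trans_lt h)), mul_zero]

end correlation

/-- The measurement integrand in the stretched variables `m = (-μ - μ₀) / θ` and
`w = (ω - ω₀) / θ`, after integration in time. -/
noncomputable def rescaledIntegrand (ε μ₀ ω₀ : ℝ) (τ ν η φt φμ φω ψt : ℝ → ℝ)
    (θ m w : ℝ) : ℝ :=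
  (η (ω₀ + θ * w) / τ (ω₀ + θ * w)) * φμ m * φω w
    * Real.exp (-2 / (ε * |μ₀ + θ * m| * ν (ω₀ + θ * w) * τ (ω₀ + θ * w)))
    * correlation φt ψt
        ((2 * ε / (|μ₀ + θ * m| * ν (ω₀ + θ * w)) - 2 * ε / (μ₀ * ν ω₀)) / θ)

lemma integral_eq_mul_integral_affine {θ : ℝ} (hθ : 0 < θ) (a : ℝ) (g : ℝ → ℝ) :
    ∫ x, g x = θ * ∫ y, g (a + θ * y) := by
  have h := Measure.integral_comp_mul_left (fun y => g (a + y)) θ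
  rw [h, integral_add_left_eq_self g a, abs_of_pos (inv_pos.2 hθ), smul_eq_mul,
    mul_inv_cancel_left₀ hθ.ne']

lemma measurement_eq_rescaled (ε μ₀ ω₀ : ℝ) (hε : 0 < ε) (hμ₀ : 0 < μ₀) (hω₀ : 0 < ω₀)
    (τ ν η φt φμ φω ψt : ℝ → ℝ) (hν : ∀ ω, 0 ≤ ν ω)
    (hφtc : Continuous φt)
    (hφts : ∀ y, y ∉ Icc (0:ℝ) 1 → φt y = 0)
    (hφμs : ∀ y, y ∉ Icc (0:ℝ) 1 → φμ y = 0)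
    (hφωs : ∀ y, y ∉ Icc (0:ℝ) 1 → φω y = 0)
    {θ : ℝ} (hθ : 0 < θ) (hθ1 : μ₀ + θ < 1) :
    ∫ μ in Ioo (-1:ℝ) 0, ∫ ω in Ioi (0:ℝ), ∫ t in Ioi (0:ℝ),
          (η ω / τ ω) * φμ ((-μ - μ₀) / θ) * φω ((ω - ω₀) / θ)
            * φt ((t - 2 * ε / (|μ| * ν ω)) / θ)
            * Real.exp (-2 / (ε * |μ| * ν ω * τ ω))
            * ψt ((t - 2 * ε / (μ₀ * ν ω₀)) / θ)
            * (if 2 * ε / (|μ| * ν ω) < t then 1 else 0)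
      = θ ^ 3 * ∫ m, ∫ w, rescaledIntegrand ε μ₀ ω₀ τ ν η φt φμ φω ψt θ m w := by
  have hinner : ∀ μ ω, ∫ t in Ioi (0:ℝ),
          (η ω / τ ω) * φμ ((-μ - μ₀) / θ) * φω ((ω - ω₀) / θ)
            * φt ((t - 2 * ε / (|μ| * ν ω)) / θ)
            * Real.exp (-2 / (ε * |μ| * ν ω * τ ω))
            * ψt ((t - 2 * ε / (μ₀ * ν ω₀)) / θ)
            * (if 2 * ε / (|μ| * ν ω) < t then 1 else 0)
      = θ * ((η ω / τ ω) * φμ ((-μ - μ₀) / θ) * φω ((ω - ω₀) / θ)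
            * Real.exp (-2 / (ε * |μ| * ν ω * τ ω))
            * correlation φt ψt
                ((2 * ε / (|μ| * ν ω) - 2 * ε / (μ₀ * ν ω₀)) / θ)) := by
    intro μ ω
    have ha : 0 ≤ 2 * ε / (|μ| * ν ω) :=
      div_nonneg (by positivity) (mul_nonneg (abs_nonneg _) (hν ω))
    rw [mul_left_comm, ← setIntegral_rescaled_eq_correlation hφtc hφts hθ ha,
      ← integral_const_mul]
    refine integral_congr_ae (.of_forall fun t => ?_)
    simp only
    ring
  have hfreq : ∀ μ, ∫ ω in Ioi (0:ℝ), θ * ((η ω / τ ω) * φμ ((-μ - μ₀) / θ) * φω ((ω - ω₀) / θ)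
            * Real.exp (-2 / (ε * |μ| * ν ω * τ ω))
            * correlation φt ψt
                ((2 * ε / (|μ| * ν ω) - 2 * ε / (μ₀ * ν ω₀)) / θ))
      = θ ^ 2 * ∫ w, rescaledIntegrand ε μ₀ ω₀ τ ν η φt φμ φω ψt θ ((-μ - μ₀) / θ) w := by
    intro μ
    rw [setIntegral_eq_integral_of_forall_compl_eq_zero,
      integral_eq_mul_integral_affine hθ ω₀, integral_const_mul, ← mul_assoc, ← sq]
    · congr 2
      ext w
      have h1 : (ω₀ + θ * w - ω₀) / θ = w := by field_simp; ring
      have h2 : μ₀ + θ * ((-μ - μ₀) / θ) = -μ := by field_simp; ring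
      simp only [rescaledIntegrand, h1, h2, abs_neg]
    · intro ω hω
      rw [hφωs ((ω - ω₀) / θ) fun h => ?_]
      · simp
      · have := (le_div_iff₀ hθ).1 h.1
        rw [mem_Ioi] at hω
        linarith
  simp_rw [hinner, hfreq]
  rw [setIntegral_eq_integral_of_forall_compl_eq_zero, ← integral_neg_eq_self,
    integral_eq_mul_integral_affine hθ μ₀, integral_const_mul, ← mul_assoc]
  · congr 1
    · ring
    · congr 1
      ext m
      have h1 : (- -(μ₀ + θ * m) - μ₀) / θ = m := by field_simp; ring
      rw [h1]
  · intro μ hμ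
    have h0 : φμ ((-μ - μ₀) / θ) = 0 := hφμs _ fun h => hμ ⟨?_, ?_⟩
    · simp [rescaledIntegrand, h0]
    · have := (div_le_iff₀ hθ).1 h.2
      linarith
    · have := (le_div_iff₀ hθ).1 h.1
      linarith

section limit

variable {ε μ₀ ω₀ τmin νmin ν'₀ : ℝ} {τ ν η φt φμ φω ψt : ℝ → ℝ}

lemma tendsto_rescaled_delay (hμ₀ : 0 < μ₀) (hν₀ : 0 < ν ω₀)
    (hν' : HasDerivAt ν ν'₀ ω₀) (m w : ℝ) :
    Tendsto (fun θ : ℝ =>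
        (2 * ε / (|μ₀ + θ * m| * ν (ω₀ + θ * w)) - 2 * ε / (μ₀ * ν ω₀)) / θ)
      (nhdsWithin 0 (Ioi 0))
      (nhds (-((2 * ε / (μ₀ * ν ω₀) ^ 2) * (m * ν ω₀ + w * μ₀ * ν'₀)))) := by
  have h1 : HasDerivAt (fun θ : ℝ => μ₀ + θ * m) m 0 := by
    simpa using ((hasDerivAt_id (0:ℝ)).mul_const m).const_add μ₀
  have h2 : HasDerivAt (fun θ : ℝ => ω₀ + θ * w) w 0 := by
    simpa using ((hasDerivAt_id (0:ℝ)).mul_const w).const_add ω₀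
  have h3 : HasDerivAt (fun θ : ℝ => ν (ω₀ + θ * w)) (ν'₀ * w) 0 :=
    HasDerivAt.comp (h₂ := ν) 0 (by simpa using hν') h2
  have h4 : HasDerivAt (fun θ : ℝ => 2 * ε / ((μ₀ + θ * m) * ν (ω₀ + θ * w)))
      (-((2 * ε / (μ₀ * ν ω₀) ^ 2) * (m * ν ω₀ + w * μ₀ * ν'₀))) 0 := by
    have hne : (μ₀ + 0 * m) * ν (ω₀ + 0 * w) ≠ 0 := by
      simpa using ⟨hμ₀.ne', hν₀.ne'⟩
    refine ((hasDerivAt_const (0:ℝ) (2 * ε)).div (h1.mul h3) hne).congr_deriv ?_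
    simp only [Pi.mul_apply, zero_mul, add_zero]
    ring
  have h5 := (hasDerivAt_iff_tendsto_slope.1 h4).mono_left
    (nhdsWithin_mono 0 fun x (hx : 0 < x) => hx.ne')
  have hpos : ∀ᶠ θ : ℝ in nhdsWithin 0 (Ioi 0), 0 < μ₀ + θ * m :=
    (h1.continuousAt.eventually (lt_mem_nhds (by simpa using hμ₀))).filter_mono nhdsWithin_le_nhds
  refine h5.congr' ?_
  filter_upwards [hpos] with θ h
  simp [slope_def_field, abs_of_pos h]

lemma tendsto_rescaledIntegrand (hε : 0 < ε) (hμ₀ : 0 < μ₀) (hν₀ : 0 < ν ω₀) (hτ₀ : 0 < τ ω₀)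
    (hτc : ContinuousAt τ ω₀) (hηc : ContinuousAt η ω₀) (hν' : HasDerivAt ν ν'₀ ω₀)
    (hcorr : Continuous (correlation φt ψt)) (m w : ℝ) :
    Tendsto (fun θ : ℝ => rescaledIntegrand ε μ₀ ω₀ τ ν η φt φμ φω ψt θ m w)
      (nhdsWithin 0 (Ioi 0))
      (nhds ((η ω₀ / τ ω₀) * φμ m * φω w * Real.exp (-2 / (ε * μ₀ * ν ω₀ * τ ω₀))
        * correlation φt ψt (-((2 * ε / (μ₀ * ν ω₀) ^ 2) * (m * ν ω₀ + w * μ₀ * ν'₀))))) := by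
  have hω : Tendsto (fun θ : ℝ => ω₀ + θ * w) (nhdsWithin 0 (Ioi 0)) (nhds ω₀) := by
    have : Continuous (fun θ : ℝ => ω₀ + θ * w) := by fun_prop
    simpa using (this.tendsto 0).mono_left nhdsWithin_le_nhds
  have hμ : Tendsto (fun θ : ℝ => |μ₀ + θ * m|) (nhdsWithin 0 (Ioi 0)) (nhds μ₀) := by
    have : Continuous (fun θ : ℝ => |μ₀ + θ * m|) := by fun_prop
    simpa [abs_of_pos hμ₀] using (this.tendsto 0).mono_left nhdsWithin_le_nhds
  have hτ := hτc.tendsto.comp hω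
  have hη := hηc.tendsto.comp hω
  have hν := hν'.continuousAt.tendsto.comp hω
  refine Tendsto.mul (Tendsto.mul (((hη.div hτ hτ₀.ne').mul_const _).mul_const _)
    ((Real.continuous_exp.tendsto _).comp (tendsto_const_nhds.div
      (((hμ.const_mul ε).mul hν).mul hτ) (by positivity))))
    ((hcorr.tendsto _).comp (tendsto_rescaled_delay hμ₀ hν₀ hν' m w))

lemma abs_rescaledIntegrand_le (hε : 0 < ε)
    (hτmin : 0 < τmin) (hτb : ∀ ω, τmin ≤ τ ω) (hνb : ∀ ω, 0 ≤ ν ω)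
    (hηb : ∀ ω, η ω ∈ Icc (0:ℝ) 1)
    (hφtc : Continuous φt) (hφts : HasCompactSupport φt) (hφt0 : ∀ y, 0 ≤ φt y)
    (hφμ0 : ∀ y, 0 ≤ φμ y) (hφω0 : ∀ y, 0 ≤ φω y)
    (hψb : ∀ y, ψt y ∈ Icc (0:ℝ) 1) (θ m w : ℝ) :
    |rescaledIntegrand ε μ₀ ω₀ τ ν η φt φμ φω ψt θ m w| ≤
      (1 / τmin * ∫ s, φt s) * (φμ m * φω w) := by
  have hτ := hτb (ω₀ + θ * w)
  have hη := hηb (ω₀ + θ * w)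
  have hν := hνb (ω₀ + θ * w)
  have hτ0 : 0 < τ (ω₀ + θ * w) := hτmin.trans_le hτ
  have hm := hφμ0 m
  have hw := hφω0 w
  have hexp : Real.exp (-2 / (ε * |μ₀ + θ * m| * ν (ω₀ + θ * w) * τ (ω₀ + θ * w))) ≤ 1 :=
    Real.exp_le_one_iff.2 (div_nonpos_of_nonpos_of_nonneg (by norm_num) (by positivity))
  have hq : η (ω₀ + θ * w) / τ (ω₀ + θ * w) ≤ 1 / τmin := div_le_div₀ zero_le_one hη.2 hτmin hτ
  have hq0 : 0 ≤ η (ω₀ + θ * w) / τ (ω₀ + θ * w) := div_nonneg hη.1 hτ0.le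
  have hc := abs_correlation_le hφtc hφts hφt0 hψb
    ((2 * ε / (|μ₀ + θ * m| * ν (ω₀ + θ * w)) - 2 * ε / (μ₀ * ν ω₀)) / θ)
  rw [rescaledIntegrand, abs_mul, abs_of_nonneg (by positivity)]
  calc _ ≤ (1 / τmin * φμ m * φω w * 1) * ∫ s, φt s := by gcongr
    _ = _ := by ring

lemma measurable_rescaledIntegrand (hτm : Measurable τ) (hνm : Measurable ν) (hηm : Measurable η)
    (hφμc : Continuous φμ) (hφωc : Continuous φω)
    (hcorr : Continuous (correlation φt ψt)) (θ : ℝ) :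
    Measurable fun p : ℝ × ℝ => rescaledIntegrand ε μ₀ ω₀ τ ν η φt φμ φω ψt θ p.1 p.2 := by
  have := hφμc.measurable
  have := hφωc.measurable
  have := hcorr.measurable
  unfold rescaledIntegrand
  fun_prop

lemma tendsto_integral_rescaledIntegrand (hε : 0 < ε) (hμ₀ : 0 < μ₀)
    (hτm : Measurable τ) (hνm : Measurable ν) (hηm : Measurable η)
    (hτmin : 0 < τmin) (hτb : ∀ ω, τmin ≤ τ ω) (hνmin : 0 < νmin) (hνb : ∀ ω, νmin ≤ ν ω)
    (hηb : ∀ ω, η ω ∈ Icc (0:ℝ) 1)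
    (hτc : ContinuousAt τ ω₀) (hηc : ContinuousAt η ω₀) (hν' : HasDerivAt ν ν'₀ ω₀)
    (hφtc : Continuous φt) (hφμc : Continuous φμ) (hφωc : Continuous φω)
    (hφts : HasCompactSupport φt) (hφμs : HasCompactSupport φμ) (hφωs : HasCompactSupport φω)
    (hφt0 : ∀ y, 0 ≤ φt y) (hφμ0 : ∀ y, 0 ≤ φμ y) (hφω0 : ∀ y, 0 ≤ φω y)
    (hψc : Continuous ψt) (hψb : ∀ y, ψt y ∈ Icc (0:ℝ) 1) :
    Tendsto (fun θ : ℝ => ∫ m, ∫ w, rescaledIntegrand ε μ₀ ω₀ τ ν η φt φμ φω ψt θ m w)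
      (nhdsWithin 0 (Ioi 0))
      (nhds (∫ p : ℝ × ℝ, (η ω₀ / τ ω₀) * φμ p.1 * φω p.2
        * Real.exp (-2 / (ε * μ₀ * ν ω₀ * τ ω₀))
        * correlation φt ψt
            (-((2 * ε / (μ₀ * ν ω₀) ^ 2) * (p.1 * ν ω₀ + p.2 * μ₀ * ν'₀))))) := by
  have hcorr := continuous_correlation hφtc hφts hφt0 hψc hψb
  have hmeas := measurable_rescaledIntegrand (ε := ε) (μ₀ := μ₀) (ω₀ := ω₀) hτm hνm hηm
    hφμc hφωc hcorr
  have hbound (θ m w : ℝ) := abs_rescaledIntegrand_le (μ₀ := μ₀) (ω₀ := ω₀) hε hτmin hτb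
    (fun ω => hνmin.le.trans (hνb ω)) hηb hφtc hφts hφt0 hφμ0 hφω0 hψb θ m w
  have hdom : Integrable fun p : ℝ × ℝ => (1 / τmin * ∫ s, φt s) * (φμ p.1 * φω p.2) :=
    ((hφμc.integrable_of_hasCompactSupport hφμs).mul_prod
      (hφωc.integrable_of_hasCompactSupport hφωs)).const_mul _
  have hprod (θ : ℝ) : ∫ m, ∫ w, rescaledIntegrand ε μ₀ ω₀ τ ν η φt φμ φω ψt θ m w =
      ∫ p : ℝ × ℝ, rescaledIntegrand ε μ₀ ω₀ τ ν η φt φμ φω ψt θ p.1 p.2 :=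
    (integral_prod _ (hdom.mono' (hmeas θ).aestronglyMeasurable
      (.of_forall fun p => hbound θ p.1 p.2))).symm
  simp_rw [hprod]
  exact tendsto_integral_filter_of_dominated_convergence _
    (.of_forall fun θ => (hmeas θ).aestronglyMeasurable)
    (.of_forall fun θ => .of_forall fun p => hbound θ p.1 p.2) hdom
    (.of_forall fun p => tendsto_rescaledIntegrand hε hμ₀ (hνmin.trans_le (hνb _))
      (hτmin.trans_le (hτb _)) hτc hηc hν' hcorr p.1 p.2)

end limit

lemma setIntegral_iterated_eq_integral_correlation {φt φμ φω ψt : ℝ → ℝ}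
    (hφtc : Continuous φt) (hφμc : Continuous φμ) (hφωc : Continuous φω)
    (hφts : ∀ y, y ∉ Icc (0:ℝ) 1 → φt y = 0)
    (hφμs : ∀ y, y ∉ Icc (0:ℝ) 1 → φμ y = 0)
    (hφωs : ∀ y, y ∉ Icc (0:ℝ) 1 → φω y = 0)
    (hψc : Continuous ψt) {d : ℝ → ℝ → ℝ} (hd : Continuous fun p : ℝ × ℝ => d p.1 p.2) :
    ∫ t in Ioi (0:ℝ), ∫ w in Ioi (0:ℝ), ∫ m in Icc (-1:ℝ) 1,
        φμ m * φω w * φt t * ψt (t - d m w) =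
      ∫ p : ℝ × ℝ, φμ p.1 * φω p.2 * correlation φt ψt (-d p.1 p.2) := by
  have hm : ∀ t w, ∫ m in Icc (-1:ℝ) 1, φμ m * φω w * φt t * ψt (t - d m w) =
      ∫ m, φμ m * φω w * φt t * ψt (t - d m w) := fun t w =>
    setIntegral_eq_integral_of_forall_compl_eq_zero fun m hm => by
      rw [hφμs m fun h => hm ⟨by linarith [h.1], h.2⟩]
      simp
  have hw : ∀ t, ∫ w in Ioi (0:ℝ), ∫ m, φμ m * φω w * φt t * ψt (t - d m w) =
      ∫ w, ∫ m, φμ m * φω w * φt t * ψt (t - d m w) := fun t =>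
    setIntegral_eq_integral_of_forall_compl_eq_zero fun w hw => by
      simp [eq_zero_of_nonpos_of_support_Icc hφωc hφωs (not_lt.1 hw)]
  have ht : ∫ t in Ioi (0:ℝ), ∫ w, ∫ m, φμ m * φω w * φt t * ψt (t - d m w) =
      ∫ t, ∫ w, ∫ m, φμ m * φω w * φt t * ψt (t - d m w) :=
    setIntegral_eq_integral_of_forall_compl_eq_zero fun t ht => by
      simp [eq_zero_of_nonpos_of_support_Icc hφtc hφts (not_lt.1 ht)]
  have hslice : ∀ t, Integrable fun p : ℝ × ℝ =>
      φμ p.1 * φω p.2 * φt t * ψt (t - d p.1 p.2) := by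
    intro t
    refine Continuous.integrable_of_hasCompactSupport (by fun_prop)
      (HasCompactSupport.intro (isCompact_Icc.prod isCompact_Icc : IsCompact
        (Icc (0:ℝ) 1 ×ˢ Icc (0:ℝ) 1)) fun p hp => ?_)
    rw [mem_prod, not_and_or] at hp
    rcases hp with hp | hp
    · simp [hφμs _ hp]
    · simp [hφωs _ hp]
  have hjoint : Integrable (Function.uncurry fun (t : ℝ) (p : ℝ × ℝ) =>
      φμ p.1 * φω p.2 * φt t * ψt (t - d p.1 p.2)) := by
    have hd' : Continuous fun q : ℝ × ℝ × ℝ => d q.2.1 q.2.2 := hd.comp continuous_snd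
    refine Continuous.integrable_of_hasCompactSupport
      (by simp only [Function.uncurry_def]; fun_prop)
      (HasCompactSupport.intro (isCompact_Icc.prod (isCompact_Icc.prod isCompact_Icc) : IsCompact
        (Icc (0:ℝ) 1 ×ˢ Icc (0:ℝ) 1 ×ˢ Icc (0:ℝ) 1)) fun p hp => ?_)
    rw [mem_prod, mem_prod, not_and_or, not_and_or] at hp
    rcases hp with hp | hp | hp
    · simp [Function.uncurry_def, hφts _ hp]
    · simp [Function.uncurry_def, hφμs _ hp]
    · simp [Function.uncurry_def, hφωs _ hp]
  simp_rw [hm, hw]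
  rw [ht]
  have hpair : ∀ t, ∫ w, ∫ m, φμ m * φω w * φt t * ψt (t - d m w) =
      ∫ p : ℝ × ℝ, φμ p.1 * φω p.2 * φt t * ψt (t - d p.1 p.2) := fun t =>
    (integral_prod_symm _ (hslice t)).symm
  simp_rw [hpair]
  rw [integral_integral_swap hjoint]
  refine integral_congr_ae (.of_forall fun p => ?_)
  simp only [correlation, ← integral_const_mul]
  refine integral_congr_ae (.of_forall fun t => ?_)
  simp only [sub_eq_add_neg]
  ring

/-- A function continuous on `(0, ∞)`, extended by a constant, is measurable. -/
lemma measurable_piecewise_Ioi_const {f : ℝ → ℝ} (hf : ContinuousOn f (Ioi 0)) (c : ℝ) :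
    Measurable fun ω => if 0 < ω then f ω else c := by
  have h := hf.measurable_piecewise (continuousOn_const (c := c) (s := (Ioi (0:ℝ))ᶜ))
    measurableSet_Ioi
  convert h using 1
  ext ω
  simp [piecewise]



/-- Limit of the ballistic contribution to the temperature measurement in the outgoing
directions `μ < 0`, with a source concentrated at the common scale `θ` in time,
direction cosine, and frequency: as `θ → 0⁺` the measurement converges to
`c₁ η(ω₀) e^{-2/(εμ₀ν(ω₀)τ(ω₀))}`. -/
theorem ballistic_measurement_limit_isotropic
    (ε μ₀ ω₀ : ℝ) (hε : 0 < ε) (hμ₀ : μ₀ ∈ Set.Ioo (0:ℝ) 1) (hω₀ : 0 < ω₀)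
    (τ ν η : ℝ → ℝ) (τmin νmin νmax Cτ ν'₀ : ℝ)
    (hτc : ContinuousOn τ (Set.Ioi 0)) (hτmin : 0 < τmin) (hτb : ∀ ω > (0:ℝ), τmin ≤ τ ω)
    (hνc : ContinuousOn ν (Set.Ioi 0)) (hνmin : 0 < νmin)
    (hνb : ∀ ω > (0:ℝ), νmin ≤ ν ω ∧ ν ω ≤ νmax)
    (hν' : HasDerivAt ν ν'₀ ω₀)
    (hηm : Measurable η) (hηb : ∀ ω > (0:ℝ), η ω ∈ Set.Icc (0:ℝ) 1)
    (hηc : ContinuousAt η ω₀)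
    (hCτ : 0 < Cτ)
    (φt φμ φω : ℝ → ℝ)
    (hφtc : Continuous φt) (hφμc : Continuous φμ) (hφωc : Continuous φω)
    (hφt0 : ∀ y, 0 ≤ φt y) (hφμ0 : ∀ y, 0 ≤ φμ y) (hφω0 : ∀ y, 0 ≤ φω y)
    (hφts : ∀ y, y ∉ Set.Icc (0:ℝ) 1 → φt y = 0)
    (hφμs : ∀ y, y ∉ Set.Icc (0:ℝ) 1 → φμ y = 0)
    (hφωs : ∀ y, y ∉ Set.Icc (0:ℝ) 1 → φω y = 0)
    (ψt : ℝ → ℝ) (hψc : Continuous ψt) (hψb : ∀ y, ψt y ∈ Set.Icc (0:ℝ) 1)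
    (hψs : ∀ y, y ∉ Set.Ioo (-1:ℝ) 1 → ψt y = 0) :
    Filter.Tendsto
      (fun θ : ℝ => (1 / (θ ^ 3 * Cτ)) *
        ∫ μ in Set.Ioo (-1:ℝ) 0, ∫ ω in Set.Ioi (0:ℝ), ∫ t in Set.Ioi (0:ℝ),
          (η ω / τ ω) * φμ ((-μ - μ₀) / θ) * φω ((ω - ω₀) / θ)
            * φt ((t - 2 * ε / (|μ| * ν ω)) / θ)
            * Real.exp (-2 / (ε * |μ| * ν ω * τ ω))
            * ψt ((t - 2 * ε / (μ₀ * ν ω₀)) / θ)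
            * (if 2 * ε / (|μ| * ν ω) < t then 1 else 0))
      (nhdsWithin 0 (Set.Ioi 0))
      (nhds (((1 / (τ ω₀ * Cτ)) *
          ∫ t' in Set.Ioi (0:ℝ), ∫ ω' in Set.Ioi (0:ℝ), ∫ μ' in Set.Icc (-1:ℝ) 1,
            φμ μ' * φω ω' * φt t'
              * ψt (t' - (2 * ε / (μ₀ * ν ω₀) ^ 2) * (μ' * ν ω₀ + ω' * μ₀ * ν'₀)))
        * η ω₀ * Real.exp (-2 / (ε * μ₀ * ν ω₀ * τ ω₀)))) := by
  set τ' : ℝ → ℝ := fun ω => if 0 < ω then τ ω else τmin with hτ'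
  set νe : ℝ → ℝ := fun ω => if 0 < ω then ν ω else νmin with hνe
  set η' : ℝ → ℝ := fun ω => if 0 < ω then η ω else 0 with hη'
  have hpos : ∀ᶠ ω in nhds ω₀, 0 < ω := lt_mem_nhds hω₀
  have eτ : ∀ ω, 0 < ω → τ' ω = τ ω := fun ω h => if_pos h
  have eν : ∀ ω, 0 < ω → νe ω = ν ω := fun ω h => if_pos h
  have eη : ∀ ω, 0 < ω → η' ω = η ω := fun ω h => if_pos h
  have hτ'b : ∀ ω, τmin ≤ τ' ω := fun ω => by
    by_cases h : 0 < ω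
    · rw [eτ ω h]; exact hτb ω h
    · simp [hτ', h]
  have hνeb : ∀ ω, νmin ≤ νe ω := fun ω => by
    by_cases h : 0 < ω
    · rw [eν ω h]; exact (hνb ω h).1
    · simp [hνe, h]
  have hη'b : ∀ ω, η' ω ∈ Icc (0:ℝ) 1 := fun ω => by
    by_cases h : 0 < ω
    · rw [eη ω h]; exact hηb ω h
    · simp [hη', h]
  have hη'm : Measurable η' := Measurable.ite measurableSet_Ioi hηm measurable_const
  have hτ'c : ContinuousAt τ' ω₀ :=
    (hτc.continuousAt (Ioi_mem_nhds hω₀)).congr (hpos.mono fun ω h => (eτ ω h).symm)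
  have hη'c : ContinuousAt η' ω₀ := hηc.congr (hpos.mono fun ω h => (eη ω h).symm)
  have hνe' : HasDerivAt νe ν'₀ ω₀ := hν'.congr_of_eventuallyEq (hpos.mono fun ω h => eν ω h)
  have hlim := (tendsto_integral_rescaledIntegrand hε hμ₀.1
    (τ := τ') (ν := νe) (measurable_piecewise_Ioi_const hτc τmin)
    (measurable_piecewise_Ioi_const hνc νmin) hη'm
    hτmin hτ'b hνmin hνeb hη'b hτ'c hη'c hνe' hφtc hφμc hφωc
    (HasCompactSupport.intro isCompact_Icc hφts) (HasCompactSupport.intro isCompact_Icc hφμs)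
    (HasCompactSupport.intro isCompact_Icc hφωs) hφt0 hφμ0 hφω0 hψc hψb).const_mul (1 / Cτ)
  rw [eτ ω₀ hω₀, eν ω₀ hω₀, eη ω₀ hω₀] at hlim
  have hsmall : ∀ᶠ θ : ℝ in nhdsWithin 0 (Ioi 0), μ₀ + θ < 1 := by
    filter_upwards [nhdsWithin_le_nhds (gt_mem_nhds (sub_pos.2 hμ₀.2))] with θ h
    linarith
  rw [setIntegral_iterated_eq_integral_correlation
    (d := fun m w => (2 * ε / (μ₀ * ν ω₀) ^ 2) * (m * ν ω₀ + w * μ₀ * ν'₀))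
    hφtc hφμc hφωc hφts hφμs hφωs hψc (by fun_prop)]
  refine (hlim.congr' ?_).trans_eq ?_
  · filter_upwards [hsmall, self_mem_nhdsWithin] with θ h1 hθ
    have hθ : 0 < θ := hθ
    have key := measurement_eq_rescaled ε μ₀ ω₀ hε hμ₀.1 hω₀ τ' νe η' φt φμ φω ψt
      (fun ω => hνmin.le.trans (hνeb ω)) hφtc hφts hφμs hφωs hθ h1
    have hcongr : ∀ μ : ℝ, ∫ ω in Ioi (0:ℝ), ∫ t in Ioi (0:ℝ),
          (η' ω / τ' ω) * φμ ((-μ - μ₀) / θ) * φω ((ω - ω₀) / θ)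
            * φt ((t - 2 * ε / (|μ| * νe ω)) / θ)
            * Real.exp (-2 / (ε * |μ| * νe ω * τ' ω))
            * ψt ((t - 2 * ε / (μ₀ * νe ω₀)) / θ)
            * (if 2 * ε / (|μ| * νe ω) < t then 1 else 0) =
        ∫ ω in Ioi (0:ℝ), ∫ t in Ioi (0:ℝ),
          (η ω / τ ω) * φμ ((-μ - μ₀) / θ) * φω ((ω - ω₀) / θ)
            * φt ((t - 2 * ε / (|μ| * ν ω)) / θ)
            * Real.exp (-2 / (ε * |μ| * ν ω * τ ω))
            * ψt ((t - 2 * ε / (μ₀ * ν ω₀)) / θ)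
            * (if 2 * ε / (|μ| * ν ω) < t then 1 else 0) := fun μ =>
      setIntegral_congr_fun measurableSet_Ioi fun ω hω => by
        simp only [eτ ω hω, eν ω hω, eη ω hω, eν ω₀ hω₀]
    simp_rw [hcongr] at key
    rw [key]
    field_simp
  · refine congrArg nhds ?_
    rw [mul_assoc (1 / (τ ω₀ * Cτ) * _), mul_right_comm (1 / (τ ω₀ * Cτ)),
      ← integral_const_mul, ← integral_const_mul]
    refine integral_congr_ae (.of_forall fun p => ?_)
    simp only
    ring
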